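/- arXiv:1612.05182 — 2 statements merged into one kernel-verified Lean document; each statement's English description precedes it below -/
import Mathlib

section
/- Assume n > 1 and that char 𝕜 = 0 or char 𝕜 ≥ n. For each set partition P of Fin k having exactly n blocks, choose a surjection p_P : Fin k → Fin n whose fibers are the blocks of P and a section r_P of p_P; for each set partition P having exactly n−1 blocks, choose a surjection p_P : Fin k → Fin (n−1) whose fibers are the blocks of P and a section r_P of p_P. Then the family consisting of the functionals Φ_P for all set partitions P of Fin k with at most n blocks, together with the functionals J_{p_P,r_P} for partitions P with exactly n blocks and J'_{p_P,r_P} for partitions P with exactly n−1 blocks, is a basis of the space of linear functionals φ : W_k → 𝕜 invariant under all even permutations (φ(σ • g) = φ(g) for all σ in the alternating group of Fin n). (This is the concrete content of Theorem B, the faithfulness of Ψ, combined with the basis of Hom_{JP(n)}(k,0) from Proposition on bases for JP.) -/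
open scoped Classical

noncomputable section

namespace Jellyfish

variable {𝕜 : Type*} [Field 𝕜]

/-- The indicator (delta) function `δ_i` of a tuple `i`, a basis vector of
`W = (ι → Fin n) → 𝕜`. -/
def delta {ι : Type*} {n : ℕ} (i : ι → Fin n) : (ι → Fin n) → 𝕜 :=
  fun j => if j = i then 1 else 0

/-- The linear action of `Equiv.Perm (Fin n)` on `(ι → Fin n) → 𝕜`; it satisfies
`permAct σ (delta i) = delta (σ ∘ i)`. -/
def permAct {ι : Type*} {n : ℕ} (σ : Equiv.Perm (Fin n)) (g : (ι → Fin n) → 𝕜) :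
    (ι → Fin n) → 𝕜 :=
  fun j => g (⇑σ.symm ∘ j)

/-- `DET i`: the determinant of the `n × n` matrix whose `b`-th column is the standard
basis vector `e_{i b}`; entry `(a,b)` is `1` if `i b = a` and `0` otherwise. -/
def DET {n : ℕ} (i : Fin n → Fin n) : 𝕜 :=
  Matrix.det (Matrix.of fun a b => if i b = a then (1 : 𝕜) else 0)

/-- `a` and `b` lie in a common block of the set partition `P`. -/
def sameBlock {ι : Type*} [DecidableEq ι] [Fintype ι]
    (P : Finpartition (Finset.univ : Finset ι)) (a b : ι) : Prop :=
  ∃ B ∈ P.parts, a ∈ B ∧ b ∈ B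

/-- The tuple `i` is constant on every block of the set partition `P`. -/
def constOnBlocks {ι : Type*} [DecidableEq ι] [Fintype ι] {n : ℕ}
    (P : Finpartition (Finset.univ : Finset ι)) (i : ι → Fin n) : Prop :=
  ∀ a b : ι, sameBlock P a b → i a = i b

/-- The kernel (partition into fibers) of the map `p` equals the set partition `P`. -/
def kernelEq {ι : Type*} [DecidableEq ι] [Fintype ι] {m : ℕ}
    (p : ι → Fin m) (P : Finpartition (Finset.univ : Finset ι)) : Prop :=
  ∀ a b : ι, p a = p b ↔ sameBlock P a b

/-- The linear functional `Φ_P` with `Φ_P (δ_i) = 1` if `i` is constant on every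
block of `P`, and `0` otherwise. -/
def PhiP {k n : ℕ} (P : Finpartition (Finset.univ : Finset (Fin k))) :
    ((Fin k → Fin n) → 𝕜) →ₗ[𝕜] 𝕜 :=
  ∑ i : Fin k → Fin n,
    (if constOnBlocks P i then (1 : 𝕜) else 0) •
      (LinearMap.proj i : ((Fin k → Fin n) → 𝕜) →ₗ[𝕜] 𝕜)

/-- The linear functional `f_P` with `f_P (δ_i) = 1` if the kernel of `i` equals `P`,
and `0` otherwise. -/
def fP {k n : ℕ} (P : Finpartition (Finset.univ : Finset (Fin k))) :
    ((Fin k → Fin n) → 𝕜) →ₗ[𝕜] 𝕜 :=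
  ∑ i : Fin k → Fin n,
    (if kernelEq i P then (1 : 𝕜) else 0) •
      (LinearMap.proj i : ((Fin k → Fin n) → 𝕜) →ₗ[𝕜] 𝕜)

/-- The jellyfish functional `J_{p,r}`: `J_{p,r} (δ_i) = DET (i ∘ r)` if `i` is constant
on every fiber of `p`, and `0` otherwise. -/
def Jf {k n : ℕ} (p : Fin k → Fin n) (r : Fin n → Fin k) :
    ((Fin k → Fin n) → 𝕜) →ₗ[𝕜] 𝕜 :=
  ∑ i : Fin k → Fin n,
    (if ∀ a b : Fin k, p a = p b → i a = i b then DET (i ∘ r) else (0 : 𝕜)) •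
      (LinearMap.proj i : ((Fin k → Fin n) → 𝕜) →ₗ[𝕜] 𝕜)

/-- The `n × n` matrix `M(i)` whose column `c`, for `c : Fin (n-1)` embedded as the first
`n-1` columns, is the standard basis vector `e_{i (r c)}`, and whose last column is the
all-ones vector. -/
def Mmat {k n : ℕ} (r : Fin (n - 1) → Fin k) (i : Fin k → Fin n) :
    Matrix (Fin n) (Fin n) 𝕜 :=
  Matrix.of fun a b =>
    if h : (b : ℕ) < n - 1 then (if i (r ⟨(b : ℕ), h⟩) = a then 1 else 0) else 1

/-- The jellyfish functional `J'_{p,r}` (one dangling leg): `J'_{p,r} (δ_i) = det M(i)`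
if `i` is constant on every fiber of `p`, and `0` otherwise. -/
def Jf' {k n : ℕ} (p : Fin k → Fin (n - 1)) (r : Fin (n - 1) → Fin k) :
    ((Fin k → Fin n) → 𝕜) →ₗ[𝕜] 𝕜 :=
  ∑ i : Fin k → Fin n,
    (if ∀ a b : Fin k, p a = p b → i a = i b then (Mmat r i).det else (0 : 𝕜)) •
      (LinearMap.proj i : ((Fin k → Fin n) → 𝕜) →ₗ[𝕜] 𝕜)

/-- The linear map `T_P : W_k → W_ℓ` with `(T_P δ_i) (i') = 1` if `Sum.elim i i'` is
constant on every block of `P`, and `0` otherwise. -/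
def TP {k l n : ℕ} (P : Finpartition (Finset.univ : Finset (Fin k ⊕ Fin l))) :
    ((Fin k → Fin n) → 𝕜) →ₗ[𝕜] ((Fin l → Fin n) → 𝕜) :=
  ∑ i : Fin k → Fin n, ∑ i' : Fin l → Fin n,
    (if constOnBlocks P (Sum.elim i i') then (1 : 𝕜) else 0) •
      ((LinearMap.single 𝕜 (fun _ : Fin l → Fin n => 𝕜) i').comp
        (LinearMap.proj i : ((Fin k → Fin n) → 𝕜) →ₗ[𝕜] 𝕜))

/-- The subspace of linear functionals on `(ι → Fin n) → 𝕜` invariant under all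
permutations in `S`. -/
def invariantDual (𝕜 : Type*) [Field 𝕜] (ι : Type*) {n : ℕ}
    (S : Set (Equiv.Perm (Fin n))) :
    Submodule 𝕜 (((ι → Fin n) → 𝕜) →ₗ[𝕜] 𝕜) where
  carrier := {φ | ∀ σ ∈ S, ∀ g : (ι → Fin n) → 𝕜, φ (permAct σ g) = φ g}
  add_mem' := by
    intro φ ψ hφ hψ σ hσ g
    simp only [LinearMap.add_apply, hφ σ hσ g, hψ σ hσ g]
  zero_mem' := by intro σ hσ g; simp
  smul_mem' := by
    intro c φ hφ σ hσ g
    simp only [LinearMap.smul_apply, hφ σ hσ g]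

/-- The subspace of linear maps `W_k → W_ℓ` commuting with the actions of all
permutations in `S`. -/
def equivariantMaps (𝕜 : Type*) [Field 𝕜] (k l : ℕ) {n : ℕ}
    (S : Set (Equiv.Perm (Fin n))) :
    Submodule 𝕜 (((Fin k → Fin n) → 𝕜) →ₗ[𝕜] ((Fin l → Fin n) → 𝕜)) where
  carrier := {T | ∀ σ ∈ S, ∀ g : (Fin k → Fin n) → 𝕜, T (permAct σ g) = permAct σ (T g)}
  add_mem' := by
    intro T T' hT hT' σ hσ g
    funext j
    simp [LinearMap.add_apply, hT σ hσ g, hT' σ hσ g, permAct]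
  zero_mem' := by intro σ hσ g; funext j; simp [permAct]
  smul_mem' := by
    intro c T hT σ hσ g
    funext j
    simp [LinearMap.smul_apply, hT σ hσ g, permAct]

end Jellyfish

open Jellyfish

namespace Jellyfish

section Partitions

variable {k : ℕ} {P Q : Finpartition (Finset.univ : Finset (Fin k))}

lemma sameBlock_iff {a b : Fin k} : sameBlock P a b ↔ P.part a = P.part b := by
  rw [← P.mem_part_iff_part_eq_part (Finset.mem_univ a) (Finset.mem_univ b)]
  exact P.mem_part_iff_exists.symm

lemma le_iff_sameBlock : P ≤ Q ↔ ∀ a b, sameBlock P a b → sameBlock Q a b := by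
  constructor
  · rintro h a b ⟨B, hB, ha, hb⟩
    obtain ⟨C, hC, hBC⟩ := h hB
    exact ⟨C, hC, hBC ha, hBC hb⟩
  · intro h B hB
    obtain ⟨a, ha⟩ := P.nonempty_of_mem_parts hB
    refine ⟨Q.part a, Q.part_mem.2 (Finset.mem_univ a), fun b hb => ?_⟩
    exact Q.mem_part_iff_exists.2 (h b a ⟨B, hB, hb, ha⟩)

lemma kernelEq.unique {n : ℕ} {i : Fin k → Fin n} (hP : kernelEq i P) (hQ : kernelEq i Q) :
    P = Q :=
  le_antisymm (le_iff_sameBlock.2 fun a b h => (hQ a b).1 ((hP a b).2 h))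
    (le_iff_sameBlock.2 fun a b h => (hP a b).1 ((hQ a b).2 h))

lemma constOnBlocks_iff_le {n : ℕ} {i : Fin k → Fin n} (hQ : kernelEq i Q) :
    constOnBlocks P i ↔ P ≤ Q := by
  rw [le_iff_sameBlock]
  exact forall₂_congr fun a b => by rw [hQ a b]

lemma exists_kernelEq_partition {n : ℕ} (i : Fin k → Fin n) :
    ∃ P : Finpartition (Finset.univ : Finset (Fin k)), kernelEq i P := by
  refine ⟨Finpartition.ofSetoid (Setoid.ker i), fun a b => ?_⟩
  rw [sameBlock, ← Finpartition.mem_part_iff_exists, Finpartition.mem_part_ofSetoid_iff_rel,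
    Setoid.ker_def]
  exact eq_comm

lemma exists_kernelEq_of_card_le {n : ℕ} (h : P.parts.card ≤ n) :
    ∃ i : Fin k → Fin n, kernelEq i P := by
  refine ⟨fun a => Fin.castLE h (P.parts.equivFin ⟨P.part a, P.part_mem.2 (Finset.mem_univ a)⟩),
    fun a b => ?_⟩
  rw [sameBlock_iff, (Fin.castLE_injective h).eq_iff, Equiv.apply_eq_iff_eq, Subtype.mk.injEq]

lemma card_image_le_of_factors {α β γ : Type*} [DecidableEq β] [DecidableEq γ] (s : Finset α)
    (f : α → β) (g : α → γ) (h : ∀ a b, f a = f b → g a = g b) :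
    (s.image g).card ≤ (s.image f).card := by
  refine Finset.card_le_card_of_forall_subsingleton (fun c b => ∃ a ∈ s, f a = b ∧ g a = c) ?_ ?_
  · intro c hc
    obtain ⟨a, ha, rfl⟩ := Finset.mem_image.1 hc
    exact ⟨f a, Finset.mem_image_of_mem f ha, a, ha, rfl, rfl⟩
  · rintro b - c ⟨-, a, -, hab, hac⟩ d ⟨-, a', -, hab', had⟩
    rw [← hac, ← had]
    exact h a a' (hab.trans hab'.symm)

lemma kernelEq.card_parts {n : ℕ} {i : Fin k → Fin n} (h : kernelEq i P) :
    P.parts.card = (Finset.univ.image i).card := by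
  have hparts : P.parts = Finset.univ.image P.part := by
    ext B
    simp only [Finset.mem_image, Finset.mem_univ, true_and]
    constructor
    · intro hB
      obtain ⟨a, ha⟩ := P.nonempty_of_mem_parts hB
      exact ⟨a, P.part_eq_of_mem hB ha⟩
    · rintro ⟨a, rfl⟩
      exact P.part_mem.2 (Finset.mem_univ a)
  have hker (a b) : i a = i b ↔ P.part a = P.part b := (h a b).trans sameBlock_iff
  rw [hparts]
  exact le_antisymm (card_image_le_of_factors _ _ _ fun a b => (hker a b).1)
    (card_image_le_of_factors _ _ _ fun a b => (hker a b).2)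

lemma kernelEq.card_parts_le {n : ℕ} {i : Fin k → Fin n} (h : kernelEq i P) :
    P.parts.card ≤ n := by
  rw [h.card_parts]
  simpa using Finset.card_le_univ (Finset.univ.image i)

lemma kernelEq.perm_comp {n : ℕ} {i : Fin k → Fin n} (h : kernelEq i P)
    (σ : Equiv.Perm (Fin n)) : kernelEq (σ ∘ i) P := fun a b => by
  rw [← h a b, Function.comp_apply, Function.comp_apply, σ.injective.eq_iff]

end Partitions

lemma exists_perm_comp_eq {α β : Type*} [Finite β] {i j : α → β}
    (h : ∀ a b, i a = i b ↔ j a = j b) : ∃ σ : Equiv.Perm β, σ ∘ j = i := by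
  have := Fintype.ofFinite β
  let e : Set.range j ≃ Set.range i :=
    (Setoid.quotientKerEquivRange j).symm.trans
      ((Quotient.congrRight fun a b => (h a b).symm).trans (Setoid.quotientKerEquivRange i))
  have he (a : α) : (e ⟨j a, a, rfl⟩ : β) = i a := by
    have : (Setoid.quotientKerEquivRange j).symm ⟨j a, a, rfl⟩ = Quotient.mk _ a := by
      rw [Equiv.symm_apply_eq]; rfl
    simp only [e, Equiv.trans_apply, this]
    rfl
  refine ⟨Equiv.extendSubtype (p := (· ∈ Set.range j)) (q := (· ∈ Set.range i)) e, ?_⟩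
  funext a
  rw [Function.comp_apply, Equiv.extendSubtype_apply_of_mem _ _ ⟨a, rfl⟩]
  exact he a

section Determinants

variable {𝕜 : Type*} [Field 𝕜] {k n : ℕ}

lemma DET_perm_comp (σ : Equiv.Perm (Fin n)) (i : Fin n → Fin n) :
    (DET (σ ∘ i) : 𝕜) = ((Equiv.Perm.sign σ : ℤ) : 𝕜) * DET i := by
  have h := Matrix.det_permute σ⁻¹ (Matrix.of fun a b => if i b = a then (1 : 𝕜) else 0)
  rw [Equiv.Perm.sign_inv] at h
  rw [DET, DET, ← h]
  congr 1
  ext a b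
  simp [Equiv.eq_symm_apply]

lemma sign_cast_ne_zero (σ : Equiv.Perm (Fin n)) : ((Equiv.Perm.sign σ : ℤ) : 𝕜) ≠ 0 := by
  rcases Int.units_eq_one_or (Equiv.Perm.sign σ) with h | h <;> simp [h]

lemma DET_ne_zero_iff (i : Fin n → Fin n) : (DET i : 𝕜) ≠ 0 ↔ Function.Injective i := by
  constructor
  · intro h a b hab
    by_contra hne
    exact h (Matrix.det_zero_of_column_eq hne fun c => by simp [hab])
  · intro h
    have hi : i = Equiv.ofBijective i (Finite.injective_iff_bijective.1 h) ∘ id := rfl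
    have hid : (DET (id : Fin n → Fin n) : 𝕜) = 1 := by
      have : (Matrix.of fun a b : Fin n => if id b = a then (1 : 𝕜) else 0) = 1 := by
        ext a b
        simp [Matrix.one_apply, eq_comm]
      rw [DET, this, Matrix.det_one]
    rw [hi, DET_perm_comp, hid, mul_one]
    exact sign_cast_ne_zero _

lemma det_Mmat_perm_comp (r : Fin (n - 1) → Fin k) (σ : Equiv.Perm (Fin n)) (i : Fin k → Fin n) :
    (Mmat r (σ ∘ i) : Matrix _ _ 𝕜).det =
      ((Equiv.Perm.sign σ : ℤ) : 𝕜) * (Mmat r i).det := by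
  have h := Matrix.det_permute σ⁻¹ (Mmat r i : Matrix _ _ 𝕜)
  rw [Equiv.Perm.sign_inv] at h
  rw [← h]
  congr 1
  ext a b
  simp [Mmat, Equiv.eq_symm_apply]

lemma det_Mmat_ne_zero_iff (r : Fin (n - 1) → Fin k) (i : Fin k → Fin n) :
    (Mmat r i : Matrix _ _ 𝕜).det ≠ 0 ↔ Function.Injective (i ∘ r) := by
  have hle : n - 1 ≤ n := Nat.sub_le n 1
  constructor
  · intro h a b hab
    by_contra hne
    refine h (Matrix.det_zero_of_column_eq ((Fin.castLE_injective hle).ne hne) fun c => ?_)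
    have hab' : i (r a) = i (r b) := hab
    simp [Mmat, hab']
  · intro h
    obtain ⟨σ, hσ⟩ : ∃ σ : Equiv.Perm (Fin n), σ ∘ (i ∘ r) = Fin.castLE hle :=
      exists_perm_comp_eq fun a b => by
        rw [h.eq_iff, (Fin.castLE_injective hle).eq_iff]
    have hσ' (c) : σ (i (r c)) = Fin.castLE hle c := congrFun hσ c
    have htri : (Mmat r (σ ∘ i) : Matrix _ _ 𝕜).IsUpperTriangular := by
      intro a b hab
      have hab : b < a := hab
      have hb : (b : ℕ) < n - 1 := by omega
      simp [Mmat, hb, hσ', Fin.ext_iff]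
      omega
    have hdet : (Mmat r (σ ∘ i) : Matrix _ _ 𝕜).det = 1 := by
      rw [Matrix.det_of_isUpperTriangular htri]
      refine Finset.prod_eq_one fun a _ => ?_
      by_cases ha : (a : ℕ) < n - 1 <;> simp [Mmat, ha, hσ', Fin.ext_iff]
    intro h0
    rw [det_Mmat_perm_comp, h0, mul_zero] at hdet
    exact zero_ne_one hdet

end Determinants

section Functionals

variable {𝕜 : Type*} [Field 𝕜] {k n : ℕ}

lemma sum_smul_proj_delta (c : (Fin k → Fin n) → 𝕜) (i : Fin k → Fin n) :
    (∑ j, c j • (LinearMap.proj j : ((Fin k → Fin n) → 𝕜) →ₗ[𝕜] 𝕜)) (delta i) = c i := by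
  simp [delta]

lemma PhiP_delta (P : Finpartition (Finset.univ : Finset (Fin k))) (i : Fin k → Fin n) :
    PhiP P (delta i) = if constOnBlocks P i then (1 : 𝕜) else 0 :=
  sum_smul_proj_delta _ i

lemma permAct_delta (σ : Equiv.Perm (Fin n)) (i : Fin k → Fin n) :
    permAct σ (delta i : _ → 𝕜) = delta (σ ∘ i) := by
  funext j
  simp only [permAct, delta]
  congr 1
  simp only [funext_iff, Function.comp_apply, Equiv.symm_apply_eq]

lemma functional_ext {φ ψ : ((Fin k → Fin n) → 𝕜) →ₗ[𝕜] 𝕜}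
    (h : ∀ i, φ (delta i) = ψ (delta i)) : φ = ψ := by
  refine (Pi.basisFun 𝕜 (Fin k → Fin n)).ext fun i => ?_
  have hi : Pi.basisFun 𝕜 (Fin k → Fin n) i = delta i := by
    funext j
    simp [delta, Pi.single_apply]
  rw [hi, h i]

lemma mem_invariantDual_iff {S : Set (Equiv.Perm (Fin n))}
    {φ : ((Fin k → Fin n) → 𝕜) →ₗ[𝕜] 𝕜} :
    φ ∈ invariantDual 𝕜 (Fin k) S ↔ ∀ σ ∈ S, ∀ i, φ (delta (σ ∘ i)) = φ (delta i) := by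
  constructor
  · intro h σ hσ i
    rw [← permAct_delta, h σ hσ]
  · intro h σ hσ g
    let T : ((Fin k → Fin n) → 𝕜) →ₗ[𝕜] ((Fin k → Fin n) → 𝕜) :=
      LinearMap.funLeft 𝕜 𝕜 (⇑σ.symm ∘ ·)
    have : φ ∘ₗ T = φ := functional_ext fun i => by
      rw [← h σ hσ i, ← permAct_delta]
      rfl
    exact LinearMap.congr_fun this g

/-- A functional which is sign-equivariant and does not vanish on `delta i` exactly when
the kernel of `i` is `P`. -/
structure IsSignOrbitFunctional (φ : ((Fin k → Fin n) → 𝕜) →ₗ[𝕜] 𝕜)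
    (P : Finpartition (Finset.univ : Finset (Fin k))) : Prop where
  perm_comp : ∀ (σ : Equiv.Perm (Fin n)) i,
    φ (delta (σ ∘ i)) = ((Equiv.Perm.sign σ : ℤ) : 𝕜) * φ (delta i)
  ne_zero_iff : ∀ i, φ (delta i) ≠ 0 ↔ kernelEq i P

lemma injective_comp_section_iff {m : ℕ} {P : Finpartition (Finset.univ : Finset (Fin k))}
    {p : Fin k → Fin m} {r : Fin m → Fin k} (hp : kernelEq p P) (hr : p ∘ r = id)
    (i : Fin k → Fin n) :
    ((∀ a b, p a = p b → i a = i b) ∧ Function.Injective (i ∘ r)) ↔ kernelEq i P := by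
  have hpr (c) : p (r c) = c := congrFun hr c
  constructor
  · rintro ⟨hc, hinj⟩ a b
    rw [← hp a b]
    refine ⟨fun hab => hinj ?_, hc a b⟩
    rw [Function.comp_apply, Function.comp_apply, hc (r (p a)) a (hpr _),
      hc (r (p b)) b (hpr _), hab]
  · intro h
    refine ⟨fun a b hab => (h a b).2 ((hp a b).1 hab), fun c d hcd => ?_⟩
    rw [← hpr c, ← hpr d]
    exact (hp _ _).2 ((h _ _).1 hcd)

lemma isSignOrbitFunctional_of_det {m : ℕ} {P : Finpartition (Finset.univ : Finset (Fin k))}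
    {p : Fin k → Fin m} {r : Fin m → Fin k} (hp : kernelEq p P) (hr : p ∘ r = id)
    {D : (Fin k → Fin n) → 𝕜}
    (hD : ∀ (σ : Equiv.Perm (Fin n)) i, D (σ ∘ i) = ((Equiv.Perm.sign σ : ℤ) : 𝕜) * D i)
    (hD' : ∀ i, D i ≠ 0 ↔ Function.Injective (i ∘ r)) :
    IsSignOrbitFunctional (∑ i : Fin k → Fin n,
      (if ∀ a b : Fin k, p a = p b → i a = i b then D i else (0 : 𝕜)) •
        (LinearMap.proj i : ((Fin k → Fin n) → 𝕜) →ₗ[𝕜] 𝕜)) P where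
  perm_comp σ i := by
    rw [sum_smul_proj_delta, sum_smul_proj_delta, hD]
    simp only [Function.comp_apply, σ.injective.eq_iff, mul_ite, mul_zero]
  ne_zero_iff i := by
    rw [sum_smul_proj_delta, ← injective_comp_section_iff hp hr, ← hD']
    simp only [ne_eq, ite_eq_right_iff, Classical.not_imp]

lemma isSignOrbitFunctional_Jf {P : Finpartition (Finset.univ : Finset (Fin k))}
    {p : Fin k → Fin n} {r : Fin n → Fin k} (hp : kernelEq p P) (hr : p ∘ r = id) :
    IsSignOrbitFunctional (Jf p r : _ →ₗ[𝕜] 𝕜) P :=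
  isSignOrbitFunctional_of_det hp hr (fun σ i => DET_perm_comp σ (i ∘ r))
    fun i => DET_ne_zero_iff (i ∘ r)

lemma isSignOrbitFunctional_Jf' {P : Finpartition (Finset.univ : Finset (Fin k))}
    {p : Fin k → Fin (n - 1)} {r : Fin (n - 1) → Fin k} (hp : kernelEq p P) (hr : p ∘ r = id) :
    IsSignOrbitFunctional (Jf' p r : _ →ₗ[𝕜] 𝕜) P :=
  isSignOrbitFunctional_of_det hp hr (det_Mmat_perm_comp r) (det_Mmat_ne_zero_iff r)

lemma PhiP_delta_perm_comp (P : Finpartition (Finset.univ : Finset (Fin k)))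
    (σ : Equiv.Perm (Fin n)) (i : Fin k → Fin n) :
    PhiP P (delta (σ ∘ i)) = (PhiP P (delta i) : 𝕜) := by
  have h : constOnBlocks P (σ ∘ i) ↔ constOnBlocks P i := by
    simp only [constOnBlocks, Function.comp_apply, σ.injective.eq_iff]
  simp only [PhiP_delta, h]

lemma PhiP_mem_invariantDual (P : Finpartition (Finset.univ : Finset (Fin k)))
    (S : Set (Equiv.Perm (Fin n))) :
    (PhiP P : _ →ₗ[𝕜] 𝕜) ∈ invariantDual 𝕜 (Fin k) S :=
  mem_invariantDual_iff.2 fun σ _ i => PhiP_delta_perm_comp P σ i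

lemma IsSignOrbitFunctional.mem_invariantDual {φ : ((Fin k → Fin n) → 𝕜) →ₗ[𝕜] 𝕜}
    {P : Finpartition (Finset.univ : Finset (Fin k))} (h : IsSignOrbitFunctional φ P) :
    φ ∈ invariantDual 𝕜 (Fin k) (alternatingGroup (Fin n) : Set (Equiv.Perm (Fin n))) :=
  mem_invariantDual_iff.2 fun σ hσ i => by
    rw [h.perm_comp, Equiv.Perm.mem_alternatingGroup.1 hσ]
    simp

/-- The functionals `Φ_P`, for partitions `P` with at most `n` blocks, satisfy no nontrivial
linear relation, because `Φ_P (δ_i) = 1` exactly when `P` refines the kernel of `i`. -/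
lemma PhiP_coeff_eq_zero
    (a : {P : Finpartition (Finset.univ : Finset (Fin k)) // P.parts.card ≤ n} → 𝕜)
    (h : ∀ i : Fin k → Fin n, ∑ P, a P * PhiP P.1 (delta i) = 0) : a = 0 := by
  funext Q
  induction Q using WellFoundedLT.induction with
  | ind Q ih =>
    obtain ⟨i, hi⟩ := exists_kernelEq_of_card_le Q.2
    have hQ := h i
    rw [Finset.sum_eq_single Q] at hQ
    · rwa [PhiP_delta, if_pos ((constOnBlocks_iff_le hi).2 le_rfl), mul_one] at hQ
    · intro P _ hPQ
      rw [PhiP_delta, constOnBlocks_iff_le hi]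
      split_ifs with hle
      · rw [ih P (lt_of_le_of_ne hle hPQ), Pi.zero_apply, zero_mul]
      · rw [mul_zero]
    · simp

/-- Sign-equivariant functionals supported on distinct kernels satisfy no nontrivial
linear relation. -/
lemma IsSignOrbitFunctional.coeff_eq_zero {ι : Type*} [Fintype ι]
    {φ : ι → ((Fin k → Fin n) → 𝕜) →ₗ[𝕜] 𝕜}
    {π : ι → Finpartition (Finset.univ : Finset (Fin k))}
    (hφ : ∀ x, IsSignOrbitFunctional (φ x) (π x)) (hπ : Function.Injective π)
    (hcard : ∀ x, (π x).parts.card ≤ n) (a : ι → 𝕜)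
    (h : ∀ i : Fin k → Fin n, ∑ x, a x * φ x (delta i) = 0) : a = 0 := by
  funext x
  obtain ⟨i, hi⟩ := exists_kernelEq_of_card_le (hcard x)
  have hx := h i
  rw [Finset.sum_eq_single x] at hx
  · exact (mul_eq_zero.1 hx).resolve_right (((hφ x).ne_zero_iff i).2 hi)
  · intro y _ hyx
    by_contra hne
    exact hyx (hπ ((((hφ y).ne_zero_iff i).1 (right_ne_zero_of_mul hne)).unique hi))
  · simp

lemma linearIndependent_PhiP_sumElim (h2 : (2 : 𝕜) ≠ 0) (hn : 1 < n) {ι : Type*} [Fintype ι]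
    {φ : ι → ((Fin k → Fin n) → 𝕜) →ₗ[𝕜] 𝕜}
    {π : ι → Finpartition (Finset.univ : Finset (Fin k))}
    (hφ : ∀ x, IsSignOrbitFunctional (φ x) (π x)) (hπ : Function.Injective π)
    (hcard : ∀ x, (π x).parts.card ≤ n) :
    LinearIndependent 𝕜 (Sum.elim
      (fun P : {P : Finpartition (Finset.univ : Finset (Fin k)) // P.parts.card ≤ n} =>
        (PhiP P.1 : ((Fin k → Fin n) → 𝕜) →ₗ[𝕜] 𝕜)) φ) := by
  rw [Fintype.linearIndependent_iff]
  intro g hg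
  have heval (i : Fin k → Fin n) : ∑ P, g (.inl P) * PhiP P.1 (delta i) +
      ∑ x, g (.inr x) * φ x (delta i) = 0 := by
    simpa [Fintype.sum_sum_type] using LinearMap.congr_fun hg (delta i)
  let τ : Equiv.Perm (Fin n) := Equiv.swap ⟨0, by omega⟩ ⟨1, hn⟩
  have hτ : Equiv.Perm.sign τ = -1 := Equiv.Perm.sign_swap (by simp)
  have hΦ (i : Fin k → Fin n) : ∑ P, g (.inl P) * PhiP P.1 (delta i) = 0 := by
    have h1 := heval i
    have h3 := heval (τ ∘ i)
    simp only [PhiP_delta_perm_comp, (hφ _).perm_comp, hτ, Units.val_neg, Units.val_one,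
      Int.cast_neg, Int.cast_one, neg_mul, one_mul, mul_neg, Finset.sum_neg_distrib] at h3
    refine (mul_eq_zero.1 (?_ : (2 : 𝕜) * _ = 0)).resolve_left h2
    linear_combination h1 + h3
  have hl := PhiP_coeff_eq_zero (fun P => g (.inl P)) hΦ
  have hr := IsSignOrbitFunctional.coeff_eq_zero hφ hπ hcard (fun x => g (.inr x)) fun i => by
    simpa [hΦ i] using heval i
  rintro (P | x)
  · exact congrFun hl P
  · exact congrFun hr x

end Functionals

/-- If the tuples `i` and `j` have a common kernel with at most `n - 2` blocks, then `i` and `j`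
are related by an even permutation. -/
lemma exists_even_perm_comp_eq {k n : ℕ} {P : Finpartition (Finset.univ : Finset (Fin k))}
    {i j : Fin k → Fin n} (hi : kernelEq i P) (hj : kernelEq j P)
    (hcard : P.parts.card + 2 ≤ n) : ∃ σ ∈ alternatingGroup (Fin n), σ ∘ j = i := by
  obtain ⟨σ, hσ⟩ := exists_perm_comp_eq fun a b => (hi a b).trans (hj a b).symm
  rcases Int.units_eq_one_or (Equiv.Perm.sign σ) with hs | hs
  · exact ⟨σ, Equiv.Perm.mem_alternatingGroup.2 hs, hσ⟩
  have hcompl : 1 < (Finset.univ.image j)ᶜ.card := by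
    rw [Finset.card_compl, ← hj.card_parts, Fintype.card_fin]
    omega
  obtain ⟨a, ha, b, hb, hab⟩ := Finset.one_lt_card.1 hcompl
  simp only [Finset.mem_compl, Finset.mem_image, Finset.mem_univ, true_and, not_exists] at ha hb
  refine ⟨σ * Equiv.swap a b, ?_, ?_⟩
  · rw [Equiv.Perm.mem_alternatingGroup, map_mul, hs, Equiv.Perm.sign_swap hab]
    simp
  · rw [← hσ]
    funext c
    simp [Equiv.swap_apply_of_ne_of_ne (ha c) (hb c)]

/-- A functional invariant under even permutations is determined by its values on one tuple for
each kernel, and on one odd translate of that tuple for kernels with `n - 1` or `n` blocks. -/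
lemma finrank_invariantDual_alternatingGroup_le (𝕜 : Type*) [Field 𝕜] {k n : ℕ} (hn : 1 < n) :
    Module.finrank 𝕜 (invariantDual 𝕜 (Fin k)
        (alternatingGroup (Fin n) : Set (Equiv.Perm (Fin n)))) ≤
      Fintype.card ({P : Finpartition (Finset.univ : Finset (Fin k)) // P.parts.card ≤ n} ⊕
        {P : Finpartition (Finset.univ : Finset (Fin k)) // P.parts.card = n} ⊕
        {P : Finpartition (Finset.univ : Finset (Fin k)) // P.parts.card = n - 1}) := by
  have : NeZero n := ⟨by omega⟩
  choose! t ht using fun (P : Finpartition (Finset.univ : Finset (Fin k)))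
    (h : P.parts.card ≤ n) => exists_kernelEq_of_card_le h
  let τ : Equiv.Perm (Fin n) := Equiv.swap ⟨0, by omega⟩ ⟨1, hn⟩
  have hτ : Equiv.Perm.sign τ = -1 := Equiv.Perm.sign_swap (by simp)
  let s : ({P : Finpartition (Finset.univ : Finset (Fin k)) // P.parts.card ≤ n} ⊕
        {P : Finpartition (Finset.univ : Finset (Fin k)) // P.parts.card = n} ⊕
        {P : Finpartition (Finset.univ : Finset (Fin k)) // P.parts.card = n - 1}) →
      Fin k → Fin n :=
    Sum.elim (fun P => t P.1) (Sum.elim (fun P => τ ∘ t P.1) fun P => τ ∘ t P.1)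
  let E : invariantDual 𝕜 (Fin k) (alternatingGroup (Fin n) : Set (Equiv.Perm (Fin n))) →ₗ[𝕜]
      (_ → 𝕜) :=
    { toFun := fun φ x => φ.1 (delta (s x))
      map_add' := fun _ _ => rfl
      map_smul' := fun _ _ => rfl }
  suffices hE : Function.Injective E by
    have h := LinearMap.finrank_le_finrank_of_injective hE
    rwa [Module.finrank_fintype_fun_eq_card] at h
  intro φ ψ h
  refine Subtype.ext (functional_ext fun i => ?_)
  have hs (x) : φ.1 (delta (s x)) = ψ.1 (delta (s x)) := congrFun h x
  have hφ := mem_invariantDual_iff.1 φ.2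
  have hψ := mem_invariantDual_iff.1 ψ.2
  obtain ⟨P, hP⟩ := exists_kernelEq_partition i
  have hle := hP.card_parts_le
  have htP : φ.1 (delta (t P)) = ψ.1 (delta (t P)) := hs (.inl ⟨P, hle⟩)
  rcases Nat.lt_or_ge n (P.parts.card + 2) with hcard | hcard
  · have hτP : φ.1 (delta (τ ∘ t P)) = ψ.1 (delta (τ ∘ t P)) := by
      rcases Nat.lt_or_ge P.parts.card n with hlt | hge
      · exact hs (.inr (.inr ⟨P, by omega⟩))
      · exact hs (.inr (.inl ⟨P, le_antisymm hle hge⟩))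
    obtain ⟨σ, hσ⟩ := exists_perm_comp_eq fun a b => (hP a b).trans (ht P hle a b).symm
    rcases Int.units_eq_one_or (Equiv.Perm.sign σ) with hsgn | hsgn
    · have hσA := Equiv.Perm.mem_alternatingGroup.2 hsgn
      rw [← hσ, hφ σ hσA, hψ σ hσA, htP]
    · have hστ : σ * τ⁻¹ ∈ alternatingGroup (Fin n) := by
        rw [Equiv.Perm.mem_alternatingGroup, map_mul, Equiv.Perm.sign_inv, hsgn, hτ]
        simp
      have hi : ⇑(σ * τ⁻¹) ∘ (τ ∘ t P) = i := by
        rw [← hσ]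
        funext c
        simp
      rw [← hi, hφ _ hστ, hψ _ hστ, hτP]
  · obtain ⟨σ, hσ, rfl⟩ := exists_even_perm_comp_eq hP (ht P hle) hcard
    rw [hφ σ hσ, hψ σ hσ, htP]

end Jellyfish

/-- under the characteristic assumptions, the functionals `Φ_P`
(partitions with at most `n` blocks), `J_{p_P,r_P}` (partitions with exactly `n` blocks)
and `J'_{p_P,r_P}` (partitions with exactly `n-1` blocks) form a basis of the space of
linear functionals on `W_k` invariant under the alternating group. -/
theorem statement1 (𝕜 : Type*) [Field 𝕜] (hchar2 : ringChar 𝕜 ≠ 2)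
    (n k : ℕ) (hn : 1 < n) (hchar : ringChar 𝕜 = 0 ∨ n ≤ ringChar 𝕜)
    (pn : ∀ P : Finpartition (Finset.univ : Finset (Fin k)),
      P.parts.card = n → Fin k → Fin n)
    (rn : ∀ P : Finpartition (Finset.univ : Finset (Fin k)),
      P.parts.card = n → Fin n → Fin k)
    (hpn : ∀ (P : Finpartition (Finset.univ : Finset (Fin k))) (h : P.parts.card = n),
      Function.Surjective (pn P h) ∧ kernelEq (pn P h) P ∧ (pn P h) ∘ (rn P h) = id)
    (pm : ∀ P : Finpartition (Finset.univ : Finset (Fin k)),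
      P.parts.card = n - 1 → Fin k → Fin (n - 1))
    (rm : ∀ P : Finpartition (Finset.univ : Finset (Fin k)),
      P.parts.card = n - 1 → Fin (n - 1) → Fin k)
    (hpm : ∀ (P : Finpartition (Finset.univ : Finset (Fin k))) (h : P.parts.card = n - 1),
      Function.Surjective (pm P h) ∧ kernelEq (pm P h) P ∧ (pm P h) ∘ (rm P h) = id) :
    let fam : ({P : Finpartition (Finset.univ : Finset (Fin k)) // P.parts.card ≤ n} ⊕
        {P : Finpartition (Finset.univ : Finset (Fin k)) // P.parts.card = n} ⊕
        {P : Finpartition (Finset.univ : Finset (Fin k)) // P.parts.card = n - 1}) →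
        (((Fin k → Fin n) → 𝕜) →ₗ[𝕜] 𝕜) :=
      Sum.elim (fun P => PhiP P.1)
        (Sum.elim (fun P => Jf (pn P.1 P.2) (rn P.1 P.2))
          (fun P => Jf' (pm P.1 P.2) (rm P.1 P.2)))
    LinearIndependent 𝕜 fam ∧
      Submodule.span 𝕜 (Set.range fam) =
        invariantDual 𝕜 (Fin k) (alternatingGroup (Fin n) : Set (Equiv.Perm (Fin n))) := by
  intro fam
  have h2 : (2 : 𝕜) ≠ 0 := Ring.two_ne_zero hchar2
  have hφ : ∀ x : {P : Finpartition (Finset.univ : Finset (Fin k)) // P.parts.card = n} ⊕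
      {P : Finpartition (Finset.univ : Finset (Fin k)) // P.parts.card = n - 1},
      IsSignOrbitFunctional (Sum.elim (fun P => (Jf (pn P.1 P.2) (rn P.1 P.2) : _ →ₗ[𝕜] 𝕜))
        (fun P => Jf' (pm P.1 P.2) (rm P.1 P.2)) x) (Sum.elim Subtype.val Subtype.val x) := by
    rintro (P | P)
    · exact isSignOrbitFunctional_Jf (hpn P.1 P.2).2.1 (hpn P.1 P.2).2.2
    · exact isSignOrbitFunctional_Jf' (hpm P.1 P.2).2.1 (hpm P.1 P.2).2.2
  have hli : LinearIndependent 𝕜 fam := by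
    refine linearIndependent_PhiP_sumElim h2 hn hφ ?_ ?_
    · refine Subtype.val_injective.sumElim Subtype.val_injective fun P Q hPQ => ?_
      have hP := P.2
      have hQ := Q.2
      rw [hPQ] at hP
      omega
    · rintro (P | P)
      · exact P.2.le
      · exact P.2.le.trans (Nat.sub_le n 1)
  refine ⟨hli, Submodule.eq_of_le_of_finrank_le (Submodule.span_le.2 ?_) ?_⟩
  · rintro _ ⟨P | x, rfl⟩
    · exact PhiP_mem_invariantDual P.1 _
    · exact (hφ x).mem_invariantDual
  · rw [finrank_span_eq_card hli]
    exact finrank_invariantDual_alternatingGroup_le 𝕜 hn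
end
end

section
/- Every linear map T : W_k → W_ℓ that commutes with the Perm (Fin n)-actions (T(σ • g) = σ • T(g) for all σ ∈ Perm (Fin n) and g ∈ W_k) is a 𝕜-linear combination of the maps T_P, where P ranges over all set partitions of Fin k ⊕ Fin ℓ. (This is part (1) of the theorem that the functor Φ : P(n) → Rep(S_n) is full.) -/
open scoped Classical

noncomputable section

namespace Jellyfish

variable {𝕜 : Type*} [Field 𝕜]

theorem sameBlock_ofSetoid_iff {ι : Type*} [DecidableEq ι] [Fintype ι] (s : Setoid ι) (a b : ι) :
    sameBlock (Finpartition.ofSetoid s) a b ↔ s a b := by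
  rw [← Finpartition.mem_part_ofSetoid_iff_rel, Finpartition.mem_part_iff_exists]
  simp only [sameBlock, and_comm]

theorem constOnBlocks_ofSetoid_iff {ι : Type*} [DecidableEq ι] [Fintype ι] {n : ℕ}
    (s : Setoid ι) (i : ι → Fin n) :
    constOnBlocks (Finpartition.ofSetoid s) i ↔ s ≤ Setoid.ker i := by
  simp only [constOnBlocks, sameBlock_ofSetoid_iff, Setoid.le_def, Setoid.ker_def]

/-- Two tuples with the same kernel lie in the same orbit of the symmetric group. -/
theorem exists_perm_comp_eq_of_ker_eq {ι α : Type*} [Finite ι] {i j : ι → α}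
    (h : Setoid.ker i = Setoid.ker j) : ∃ σ : Equiv.Perm α, σ ∘ i = j := by
  obtain ⟨σ, hσ⟩ := Equiv.Perm.exists_extending_pair (Setoid.kerLift i) (Quotient.lift j h.le)
    (Setoid.kerLift_injective i) ((Setoid.lift_injective_iff_ker_eq_of_le h.le).2 h.symm)
  exact ⟨σ, funext fun a => hσ ⟦a⟧⟩

theorem finite_setoid (ι : Type*) [Finite ι] : Finite (Setoid ι) :=
  Finite.of_injective (fun t : Setoid ι => t.r)
    fun _ _ h => Setoid.ext fun a b => iff_of_eq (congrFun (congrFun h a) b)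

/-- The indicator of the tuples with kernel `s` is a linear combination of the indicators of the
tuples constant on the blocks of a partition, by Möbius inversion over the setoids above `s`. -/
theorem ker_eq_indicator_mem_span {ι : Type*} [Finite ι] {n : ℕ} (s : Setoid ι) :
    (fun i : ι → Fin n => if s = Setoid.ker i then (1 : 𝕜) else 0) ∈
      Submodule.span 𝕜 (Set.range fun (t : Setoid ι) (i : ι → Fin n) =>
        if t ≤ Setoid.ker i then (1 : 𝕜) else 0) := by
  have := finite_setoid ι
  have := Fintype.ofFinite (Setoid ι)
  induction s using WellFoundedGT.induction with
  | ind s ih =>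
    have key : (fun i : ι → Fin n => if s = Setoid.ker i then (1 : 𝕜) else 0) =
        (fun i : ι → Fin n => if s ≤ Setoid.ker i then (1 : 𝕜) else 0) -
          ∑ t : Setoid ι with s < t, fun i => if t = Setoid.ker i then (1 : 𝕜) else 0 := by
      funext i
      simp only [Pi.sub_apply, Finset.sum_apply, Finset.sum_ite_eq', Finset.mem_filter_univ]
      grind [lt_iff_le_and_ne]
    rw [key]
    refine sub_mem (Submodule.subset_span ⟨s, rfl⟩) (sum_mem fun t ht => ih t ?_)
    simpa using ht

/-- A function on tuples that is constant on the orbits of the symmetric group is a linear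
combination of the indicators of the tuples constant on the blocks of a partition. -/
theorem mem_span_of_perm_invariant {ι : Type*} [Finite ι] {n : ℕ} (c : (ι → Fin n) → 𝕜)
    (hc : ∀ (σ : Equiv.Perm (Fin n)) (i : ι → Fin n), c (σ ∘ i) = c i) :
    c ∈ Submodule.span 𝕜 (Set.range fun (s : Setoid ι) (i : ι → Fin n) =>
        if s ≤ Setoid.ker i then (1 : 𝕜) else 0) := by
  have := finite_setoid ι
  have := Fintype.ofFinite (Setoid ι)
  have hfac : Function.FactorsThrough c (Setoid.ker : (ι → Fin n) → Setoid ι) := by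
    intro i j hij
    obtain ⟨σ, rfl⟩ := exists_perm_comp_eq_of_ker_eq hij
    exact (hc σ i).symm
  obtain ⟨g, rfl⟩ := (Function.factorsThrough_iff c).1 hfac
  have key : g ∘ Setoid.ker =
      ∑ s : Setoid ι, g s • fun i : ι → Fin n => if s = Setoid.ker i then (1 : 𝕜) else 0 := by
    funext i
    simp [Finset.sum_apply]
  rw [key]
  exact sum_mem fun s _ => Submodule.smul_mem _ _ (ker_eq_indicator_mem_span s)

/-- The linear map `W_k → W_ℓ` whose matrix coefficient at `(i, i')` is `c (Sum.elim i i')`. -/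
def ofCoeff (𝕜 : Type*) [Field 𝕜] (k l n : ℕ) : ((Fin k ⊕ Fin l → Fin n) → 𝕜) →ₗ[𝕜]
    ((Fin k → Fin n) → 𝕜) →ₗ[𝕜] ((Fin l → Fin n) → 𝕜) :=
  ∑ i : Fin k → Fin n, ∑ i' : Fin l → Fin n,
    (LinearMap.proj (Sum.elim i i') : ((Fin k ⊕ Fin l → Fin n) → 𝕜) →ₗ[𝕜] 𝕜).smulRight
      ((LinearMap.single 𝕜 (fun _ : Fin l → Fin n => 𝕜) i').comp
        (LinearMap.proj i : ((Fin k → Fin n) → 𝕜) →ₗ[𝕜] 𝕜))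

theorem ofCoeff_eq_TP {k l n : ℕ} (s : Setoid (Fin k ⊕ Fin l)) :
    ofCoeff 𝕜 k l n (fun i => if s ≤ Setoid.ker i then 1 else 0) =
      TP (Finpartition.ofSetoid s) := by
  simp [ofCoeff, TP, constOnBlocks_ofSetoid_iff, LinearMap.sum_apply]

theorem ofCoeff_apply_single {k l n : ℕ} (c : (Fin k ⊕ Fin l → Fin n) → 𝕜)
    (i : Fin k → Fin n) (i' : Fin l → Fin n) :
    ofCoeff 𝕜 k l n c (Pi.single i 1) i' = c (Sum.elim i i') := by
  simp [ofCoeff, LinearMap.sum_apply, Finset.sum_apply, Pi.single_apply]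

theorem permAct_single {ι : Type*} {n : ℕ} [DecidableEq (ι → Fin n)]
    (σ : Equiv.Perm (Fin n)) (i : ι → Fin n) :
    permAct σ (Pi.single i (1 : 𝕜)) = Pi.single (σ ∘ i) 1 := by
  funext j
  simp [permAct, Pi.single_apply, Equiv.symm_comp_eq]

end Jellyfish

open Jellyfish

/-- every linear map `W_k → W_ℓ` commuting with the `Perm (Fin n)`-actions
is a `𝕜`-linear combination of the maps `T_P`. -/
theorem statement2 (𝕜 : Type*) [Field 𝕜] (hchar : ringChar 𝕜 ≠ 2)
    (n k l : ℕ) (hn : 0 < n)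
    (T : ((Fin k → Fin n) → 𝕜) →ₗ[𝕜] ((Fin l → Fin n) → 𝕜))
    (hT : ∀ (σ : Equiv.Perm (Fin n)) (g : (Fin k → Fin n) → 𝕜),
      T (permAct σ g) = permAct σ (T g)) :
    T ∈ Submodule.span 𝕜
      (Set.range fun P : Finpartition (Finset.univ : Finset (Fin k ⊕ Fin l)) =>
        (TP P : ((Fin k → Fin n) → 𝕜) →ₗ[𝕜] ((Fin l → Fin n) → 𝕜))) := by
  have hcoeff : ofCoeff 𝕜 k l n (fun i => T (Pi.single (i ∘ Sum.inl) 1) (i ∘ Sum.inr)) = T := by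
    refine LinearMap.pi_ext' fun i => LinearMap.ext_ring (funext fun i' => ?_)
    simp [ofCoeff_apply_single]
  rw [← hcoeff]
  have hspan := Submodule.mem_map_of_mem (f := ofCoeff 𝕜 k l n) <|
    mem_span_of_perm_invariant (fun i => T (Pi.single (i ∘ Sum.inl) 1) (i ∘ Sum.inr)) fun σ i => by
      change T (Pi.single (σ ∘ (i ∘ Sum.inl)) 1) (σ ∘ (i ∘ Sum.inr)) = _
      rw [← permAct_single, hT]
      simp [permAct, ← Function.comp_assoc]
  rw [Submodule.map_span] at hspan
  refine Submodule.span_mono ?_ hspan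
  rintro _ ⟨_, ⟨s, rfl⟩, rfl⟩
  exact ⟨Finpartition.ofSetoid s, (ofCoeff_eq_TP s).symm⟩
end
end
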